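/- For every natural number n ≥ 2, the integral ∫₀¹ Pₙ(2x−1)·(2x−1)·log(x) dx equals (−1)^(n+2) / ((n+2)·(n−1)). -/

import Mathlib

open MeasureTheory Real

/-- The Legendre polynomials, defined by `P 0 x = 1`, `P 1 x = x` and the
three-term recurrence `(n+1) * P (n+1) x = (2*n+1) * x * P n x - n * P (n-1) x` for `n ≥ 1`. -/
noncomputable def legendreP : ℕ → ℝ → ℝ
  | 0, _ => 1
  | 1, x => x
  | (n + 2), x =>
      ((2 * (n + 1 : ℝ) + 1) * x * legendreP (n + 1) x - (n + 1 : ℝ) * legendreP n x)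
        / ((n + 1 : ℝ) + 1)

/-- `N n m = ∫₀¹ Pₙ(2x-1) Pₘ(2x-1) log x dx`. -/
noncomputable def N (n m : ℕ) : ℝ :=
  ∫ x in (0:ℝ)..1, legendreP n (2 * x - 1) * legendreP m (2 * x - 1) * Real.log x

/-- The derivative of `legendreP n`, given by a recurrence. -/
noncomputable def legendrePDeriv : ℕ → ℝ → ℝ
  | 0, _ => 0
  | (n + 1), x => x * legendrePDeriv n x + (n + 1 : ℝ) * legendreP n x

theorem add_two_mul_legendreP_add_two (n : ℕ) (x : ℝ) :
    (n + 2 : ℝ) * legendreP (n + 2) x =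
      (2 * n + 3 : ℝ) * x * legendreP (n + 1) x - (n + 1 : ℝ) * legendreP n x := by
  have : (n + 1 + 1 : ℝ) ≠ 0 := by positivity
  rw [legendreP]
  field_simp
  ring

theorem mul_legendrePDeriv_succ_sub (n : ℕ) (x : ℝ) :
    x * legendrePDeriv (n + 1) x - legendrePDeriv n x = (n + 1 : ℝ) * legendreP (n + 1) x := by
  induction n with
  | zero => simp [legendrePDeriv, legendreP]
  | succ n ih =>
    have h₁ : legendrePDeriv (n + 1) x = x * legendrePDeriv n x + (n + 1 : ℝ) * legendreP n x := rfl
    have h₂ := add_two_mul_legendreP_add_two n x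
    rw [legendrePDeriv]
    push_cast
    linear_combination x * ih - h₁ - h₂

theorem one_sub_sq_mul_legendrePDeriv_succ (n : ℕ) (x : ℝ) :
    (1 - x ^ 2) * legendrePDeriv (n + 1) x =
      (n + 1 : ℝ) * (legendreP n x - x * legendreP (n + 1) x) := by
  have h₁ : legendrePDeriv (n + 1) x = x * legendrePDeriv n x + (n + 1 : ℝ) * legendreP n x := rfl
  linear_combination h₁ - x * mul_legendrePDeriv_succ_sub n x

theorem hasDerivAt_legendreP (n : ℕ) (x : ℝ) :
    HasDerivAt (legendreP n) (legendrePDeriv n x) x := by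
  induction n using Nat.twoStepInduction with
  | zero => exact hasDerivAt_const x 1
  | one =>
    have : legendrePDeriv 1 x = 1 := by simp [legendrePDeriv, legendreP]
    rw [this]
    exact hasDerivAt_id x
  | more n ih₀ ih₁ =>
    have h : HasDerivAt (legendreP (n + 2)) _ x :=
      (((((hasDerivAt_id x).const_mul (2 * (n + 1 : ℝ) + 1)).mul ih₁).sub
        (ih₀.const_mul (n + 1 : ℝ))).div_const ((n + 1 : ℝ) + 1))
    convert h using 1
    have hn : (n + 1 + 1 : ℝ) ≠ 0 := by positivity
    have hC := mul_legendrePDeriv_succ_sub n x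
    rw [legendrePDeriv, eq_div_iff hn]
    push_cast
    simp only [id]
    linear_combination (-(n + 1 : ℝ)) * hC

theorem continuous_legendreP (n : ℕ) : Continuous (legendreP n) :=
  continuous_iff_continuousAt.2 fun x => (hasDerivAt_legendreP n x).continuousAt

theorem continuous_legendrePDeriv (n : ℕ) : Continuous (legendrePDeriv n) := by
  induction n with
  | zero => exact continuous_const
  | succ n ih =>
    exact (continuous_id.mul ih).add (continuous_const.mul (continuous_legendreP n))

theorem legendreP_neg_one (n : ℕ) : legendreP n (-1) = (-1) ^ n := by
  induction n using Nat.twoStepInduction with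
  | zero => rfl
  | one => simp [legendreP]
  | more n ih₀ ih₁ =>
    have hn : (n + 1 + 1 : ℝ) ≠ 0 := by positivity
    rw [legendreP, ih₀, ih₁, div_eq_iff hn]
    ring

theorem intervalIntegrable_legendreP_mul_log (n : ℕ) :
    IntervalIntegrable (fun x => legendreP n (2 * x - 1) * log x) volume 0 1 :=
  intervalIntegral.intervalIntegrable_log'.continuousOn_mul
    ((continuous_legendreP n).comp (by fun_prop : Continuous fun x : ℝ => 2 * x - 1)).continuousOn

/-- Legendre's differential equation, shifted to `[0, 1]`. -/
theorem hasDerivAt_mul_legendrePDeriv_shifted (n : ℕ) (x : ℝ) :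
    HasDerivAt (fun y : ℝ => 2 * y * (1 - y) * legendrePDeriv (n + 1) (2 * y - 1))
      (-((n + 1 : ℝ) * (n + 2)) * legendreP (n + 1) (2 * x - 1)) x := by
  have hfun : (fun y : ℝ => 2 * y * (1 - y) * legendrePDeriv (n + 1) (2 * y - 1)) =
      fun y : ℝ => (n + 1 : ℝ) / 2 *
        (legendreP n (2 * y - 1) - (2 * y - 1) * legendreP (n + 1) (2 * y - 1)) := by
    funext y
    linear_combination (1 / 2) * one_sub_sq_mul_legendrePDeriv_succ n (2 * y - 1)
  have ht : HasDerivAt (fun y : ℝ => 2 * y - 1) 2 x := by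
    simpa using ((hasDerivAt_id x).const_mul 2).sub_const 1
  have h₀ := (hasDerivAt_legendreP n (2 * x - 1)).comp x ht
  have h₁ := (hasDerivAt_legendreP (n + 1) (2 * x - 1)).comp x ht
  rw [hfun]
  refine ((h₀.sub (ht.mul h₁)).const_mul ((n + 1 : ℝ) / 2)).congr_deriv ?_
  simp only [Function.comp_apply]
  linear_combination (-(n + 1 : ℝ)) * mul_legendrePDeriv_succ_sub n (2 * x - 1)

theorem integral_legendreP_succ_mul_log (n : ℕ) :
    ∫ x in (0 : ℝ)..1, legendreP (n + 1) (2 * x - 1) * log x =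
      (-1) ^ n / ((n + 1 : ℝ) * (n + 2)) := by
  have hc : ((n + 1 : ℝ) * (n + 2)) ≠ 0 := by positivity
  set c : ℝ := (n + 1 : ℝ) * (n + 2) with hcdef
  let W : ℝ → ℝ := fun y => 2 * y * (1 - y) * legendrePDeriv (n + 1) (2 * y - 1)
  let F : ℝ → ℝ := fun y =>
    (W y * log y - (1 - y) * legendreP (n + 1) (2 * y - 1) + W y / c) / (-c)
  have hP : Continuous fun y : ℝ => legendreP (n + 1) (2 * y - 1) :=
    (continuous_legendreP (n + 1)).comp (by fun_prop)
  have hD : Continuous fun y : ℝ => legendrePDeriv (n + 1) (2 * y - 1) :=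
    (continuous_legendrePDeriv (n + 1)).comp (by fun_prop)
  have hWlog : Continuous fun y => W y * log y := by
    have : (fun y => W y * log y) =
        fun y => 2 * (1 - y) * legendrePDeriv (n + 1) (2 * y - 1) * (y * log y) := by
      funext y
      simp only [W]
      ring
    rw [this]
    have := continuous_mul_log
    fun_prop
  have hF : Continuous F := by
    have : Continuous W := by fun_prop
    fun_prop
  have hF' : ∀ x ∈ Set.Ioo (0 : ℝ) 1,
      HasDerivAt F (legendreP (n + 1) (2 * x - 1) * log x) x := by
    intro x hx
    have hx0 : x ≠ 0 := hx.1.ne'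
    have hW : HasDerivAt W _ x := hasDerivAt_mul_legendrePDeriv_shifted n x
    have ht : HasDerivAt (fun y : ℝ => 2 * y - 1) 2 x := by
      simpa using ((hasDerivAt_id x).const_mul 2).sub_const 1
    have hQ := (hasDerivAt_legendreP (n + 1) (2 * x - 1)).comp x ht
    refine ((((hW.mul (hasDerivAt_log hx0)).sub
      (((hasDerivAt_id x).const_sub 1).mul hQ)).add (hW.div_const c)).div_const
        (-c)).congr_deriv ?_
    simp only [Function.comp_apply, id, W, ← hcdef]
    field_simp
    ring
  rw [intervalIntegral.integral_eq_sub_of_hasDerivAt_of_le zero_le_one hF.continuousOn hF'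
    (intervalIntegrable_legendreP_mul_log (n + 1))]
  simp only [F, W]
  norm_num [legendreP_neg_one]
  field_simp
  ring

theorem stmt_7 (n : ℕ) (h : 2 ≤ n) :
    (∫ x in (0:ℝ)..1, legendreP n (2 * x - 1) * (2 * x - 1) * Real.log x) =
      (-1 : ℝ) ^ (n + 2) / (((n : ℝ) + 2) * ((n : ℝ) - 1)) := by
  obtain ⟨m, rfl⟩ := Nat.exists_eq_add_of_le' h
  have hm : (2 * m + 5 : ℝ) ≠ 0 := by positivity
  have hint : ∀ x : ℝ, legendreP (m + 2) (2 * x - 1) * (2 * x - 1) * log x =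
      (m + 3 : ℝ) / (2 * m + 5) * (legendreP (m + 3) (2 * x - 1) * log x) +
        (m + 2 : ℝ) / (2 * m + 5) * (legendreP (m + 1) (2 * x - 1) * log x) := by
    intro x
    have hrec := add_two_mul_legendreP_add_two (m + 1) (2 * x - 1)
    push_cast at hrec
    field_simp
    linear_combination -log x * hrec
  simp only [hint]
  rw [intervalIntegral.integral_add
    ((intervalIntegrable_legendreP_mul_log (m + 3)).const_mul _)
    ((intervalIntegrable_legendreP_mul_log (m + 1)).const_mul _),
    intervalIntegral.integral_const_mul, intervalIntegral.integral_const_mul,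
    integral_legendreP_succ_mul_log (m + 2), integral_legendreP_succ_mul_log m]
  push_cast
  have h₁ : (m + 2 - 1 : ℝ) = m + 1 := by ring
  rw [h₁]
  field_simp
  ring
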